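/- arXiv:2506.11293 — 3 statements merged into one kernel-verified Lean document; each statement's English description precedes it below -/
import Mathlib

section
/- Let A ∈ ℝ^{n×n}, B ∈ ℝ^{n×m}, Q ∈ ℝ^{n×n}, with R ∈ ℝ^{m×m} and P₀ ∈ ℝ^{n×n} symmetric, and suppose M₀ := R + Bᵀ P₀ B is invertible. Define K₀ := M₀^{-1} Bᵀ P₀ A and A_cl := A − B K₀, and define the DARE residual map 𝓡(P) := P − Q − Aᵀ P A + Aᵀ P B (R + Bᵀ P B)^{-1} Bᵀ P A on n×n real matrices (well-defined for P in a neighborhood of P₀). Then 𝓡 is Fréchet differentiable at P₀ and its derivative is the linear map ΔP ↦ ΔP − A_clᵀ ΔP A_cl. -/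
open Matrix

attribute [local instance] Matrix.normedAddCommGroup Matrix.normedSpace

/-- Matrix multiplication as a continuous bilinear map. -/
noncomputable def Matrix.mulContinuousBilin (l m n : ℕ) :
    Matrix (Fin l) (Fin m) ℝ →L[ℝ] Matrix (Fin m) (Fin n) ℝ →L[ℝ] Matrix (Fin l) (Fin n) ℝ :=
  LinearMap.toContinuousBilinearMap
    (LinearMap.mk₂ ℝ (· * ·) Matrix.add_mul (fun c M N => Matrix.smul_mul c M N) Matrix.mul_add
      fun c M N => Matrix.mul_smul M c N)

/-- `f` is Fréchet differentiable at `x`, with derivative given pointwise by the function `φ`. -/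
def HasFDerivFunAt {E F : Type*} [NormedAddCommGroup E] [NormedSpace ℝ E]
    [NormedAddCommGroup F] [NormedSpace ℝ F] (f φ : E → F) (x : E) : Prop :=
  ∃ D : E →L[ℝ] F, (∀ X, D X = φ X) ∧ HasFDerivAt f D x

namespace HasFDerivFunAt

section General

variable {E F G : Type*} [NormedAddCommGroup E] [NormedSpace ℝ E] [NormedAddCommGroup F]
  [NormedSpace ℝ F] [NormedAddCommGroup G] [NormedSpace ℝ G] {f g φ ψ : E → F} {x : E}

protected theorem const (c : F) (x : E) : HasFDerivFunAt (fun _ => c) (fun _ => 0) x :=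
  ⟨0, fun _ => rfl, hasFDerivAt_const c x⟩

protected theorem id (x : E) : HasFDerivFunAt (fun y => y) (fun X => X) x :=
  ⟨ContinuousLinearMap.id ℝ E, fun _ => rfl, hasFDerivAt_id x⟩

theorem add (hf : HasFDerivFunAt f φ x) (hg : HasFDerivFunAt g ψ x) :
    HasFDerivFunAt (fun y => f y + g y) (fun X => φ X + ψ X) x := by
  obtain ⟨D, hD, hf⟩ := hf
  obtain ⟨D', hD', hg⟩ := hg
  exact ⟨D + D', fun X => by simp [hD, hD'], hf.add hg⟩

theorem sub (hf : HasFDerivFunAt f φ x) (hg : HasFDerivFunAt g ψ x) :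
    HasFDerivFunAt (fun y => f y - g y) (fun X => φ X - ψ X) x := by
  obtain ⟨D, hD, hf⟩ := hf
  obtain ⟨D', hD', hg⟩ := hg
  exact ⟨D - D', fun X => by simp [hD, hD'], hf.sub hg⟩

theorem comp {h χ : F → G} (hh : HasFDerivFunAt h χ (f x)) (hf : HasFDerivFunAt f φ x) :
    HasFDerivFunAt (fun y => h (f y)) (fun X => χ (φ X)) x := by
  obtain ⟨D, hD, hh⟩ := hh
  obtain ⟨D', hD', hf⟩ := hf
  exact ⟨D.comp D', fun X => by simp [hD, hD'], hh.comp x hf⟩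

theorem hasFDerivAt (hf : HasFDerivFunAt f φ x) {L : E →L[ℝ] F} (hL : ∀ X, φ X = L X) :
    HasFDerivAt f L x := by
  obtain ⟨D, hD, hf⟩ := hf
  exact hf.congr_fderiv (ContinuousLinearMap.ext fun X => (hD X).trans (hL X))

end General

theorem matrix_mul {E : Type*} [NormedAddCommGroup E] [NormedSpace ℝ E] {l m n : ℕ}
    {f φ : E → Matrix (Fin l) (Fin m) ℝ} {g ψ : E → Matrix (Fin m) (Fin n) ℝ} {x : E}
    (hf : HasFDerivFunAt f φ x) (hg : HasFDerivFunAt g ψ x) :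
    HasFDerivFunAt (fun y => f y * g y) (fun X => f x * ψ X + φ X * g x) x := by
  obtain ⟨D, hD, hf⟩ := hf
  obtain ⟨D', hD', hg⟩ := hg
  refine ⟨_, fun X => ?_, (Matrix.mulContinuousBilin l m n).hasFDerivAt_of_bilinear hf hg⟩
  change f x * D' X + D X * g x = f x * ψ X + φ X * g x
  rw [hD, hD']

end HasFDerivFunAt

theorem exists_hasFDerivAt_ringInverse {S : Type*} [NormedRing S] [NormedAlgebra ℝ S]
    [CompleteSpace S] (u : Sˣ) :
    ∃ D : S →L[ℝ] S, (∀ X, D X = -(↑u⁻¹ * X * ↑u⁻¹)) ∧ HasFDerivAt Ring.inverse D (u : S) :=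
  ⟨_, fun _ => rfl, hasFDerivAt_ringInverse u⟩

theorem HasFDerivFunAt.matrix_inv {m : ℕ} {M : Matrix (Fin m) (Fin m) ℝ} (hM : IsUnit M) :
    HasFDerivFunAt (fun N => N⁻¹) (fun X => -(M⁻¹ * X * M⁻¹)) M := by
  obtain ⟨u, rfl⟩ := hM
  simp only [Matrix.nonsing_inv_eq_ringInverse, Ring.inverse_unit]
  exact @exists_hasFDerivAt_ringInverse (Matrix (Fin m) (Fin m) ℝ) Matrix.linftyOpNormedRing
    Matrix.linftyOpNormedAlgebra
    (inferInstanceAs (CompleteSpace (Fin m → Fin m → ℝ))) u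

/-- **Fréchet derivative of the DARE residual with respect to `P`.**
With `R`, `P₀` symmetric and `M₀ := R + Bᵀ P₀ B` invertible, set
`K₀ := M₀⁻¹ Bᵀ P₀ A` and `A_cl := A - B K₀`.  The DARE residual map
`𝓡(P) := P - Q - Aᵀ P A + Aᵀ P B (R + Bᵀ P B)⁻¹ Bᵀ P A` is Fréchet differentiable
at `P₀` with derivative `ΔP ↦ ΔP - A_clᵀ ΔP A_cl`. -/
theorem dare_residual_frechet_derivative
    {n m : ℕ}
    (A : Matrix (Fin n) (Fin n) ℝ) (B : Matrix (Fin n) (Fin m) ℝ)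
    (Q : Matrix (Fin n) (Fin n) ℝ) (R : Matrix (Fin m) (Fin m) ℝ)
    (P₀ : Matrix (Fin n) (Fin n) ℝ)
    (hR : Rᵀ = R) (hP₀ : P₀ᵀ = P₀)
    (M₀ : Matrix (Fin m) (Fin m) ℝ) (hM₀ : M₀ = R + Bᵀ * P₀ * B)
    (hM₀unit : IsUnit M₀)
    (K₀ : Matrix (Fin m) (Fin n) ℝ) (hK₀ : K₀ = M₀⁻¹ * Bᵀ * P₀ * A)
    (Acl : Matrix (Fin n) (Fin n) ℝ) (hAcl : Acl = A - B * K₀)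
    (𝓡 : Matrix (Fin n) (Fin n) ℝ → Matrix (Fin n) (Fin n) ℝ)
    (h𝓡 : 𝓡 = fun P => P - Q - Aᵀ * P * A + Aᵀ * P * B * (R + Bᵀ * P * B)⁻¹ * Bᵀ * P * A)
    (L : Matrix (Fin n) (Fin n) ℝ →L[ℝ] Matrix (Fin n) (Fin n) ℝ)
    (hL : ∀ ΔP, L ΔP = ΔP - Aclᵀ * ΔP * Acl) :
    HasFDerivAt 𝓡 L P₀ := by
  have hMT : M₀ᵀ = M₀ := by
    simp [hM₀, hR, hP₀, Matrix.transpose_mul, Matrix.mul_assoc]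
  have hK : K₀ᵀ = Aᵀ * P₀ * B * M₀⁻¹ := by
    simp [hK₀, Matrix.transpose_mul, Matrix.transpose_nonsing_inv, hMT, hP₀, Matrix.mul_assoc]
  have hc {k l : ℕ} (C : Matrix (Fin k) (Fin l) ℝ) := HasFDerivFunAt.const C P₀
  have hid := HasFDerivFunAt.id P₀
  have hI := (HasFDerivFunAt.matrix_inv (hM₀ ▸ hM₀unit)).comp
    ((hc R).add (((hc Bᵀ).matrix_mul hid).matrix_mul (hc B)))
  have h := ((hid.sub (hc Q)).sub (((hc Aᵀ).matrix_mul hid).matrix_mul (hc A))).add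
    ((((((hc Aᵀ).matrix_mul hid).matrix_mul (hc B)).matrix_mul hI).matrix_mul
      (hc Bᵀ)).matrix_mul hid |>.matrix_mul (hc A))
  rw [h𝓡]
  refine h.hasFDerivAt fun X => .trans ?_ (hL X).symm
  rw [hAcl, Matrix.transpose_sub, Matrix.transpose_mul, hK, hK₀, ← hM₀]
  simp only [Matrix.mul_zero, Matrix.zero_mul, zero_add, add_zero, sub_zero, Matrix.add_mul,
    Matrix.mul_sub, Matrix.sub_mul, Matrix.mul_neg, Matrix.neg_mul, Matrix.mul_assoc]
  abel
end

section
/- Let A be an n×n complex matrix with n ≥ 1, and let T be the linear endomorphism of the space of n×n complex matrices defined by T(X) = X − Aᵀ X A. Then the spectrum of T (as a linear endomorphism of a finite-dimensional ℂ-vector space) equals the set {1 − μ·ν : μ and ν are eigenvalues of A}. -/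
open Matrix

namespace Matrix

variable {ι K : Type*} [Fintype ι] [DecidableEq ι] [Field K]

theorem spectrum_transpose (A : Matrix ι ι K) : spectrum K Aᵀ = spectrum K A := by
  ext μ
  rw [mem_spectrum_iff_isRoot_charpoly, mem_spectrum_iff_isRoot_charpoly, charpoly_transpose]

theorem mem_spectrum_of_mul_eq_smul {A X : Matrix ι ι K} {μ : K} (hX : X ≠ 0)
    (h : A * X = μ • X) : μ ∈ spectrum K A := by
  rw [spectrum.mem_iff]
  intro hu
  refine hX ((hu.mul_right_eq_zero).1 ?_)
  rw [sub_mul, h, ← Algebra.smul_def, sub_self]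

theorem exists_mulVec_eq_smul_of_mem_spectrum {A : Matrix ι ι K} {μ : K}
    (h : μ ∈ spectrum K A) : ∃ v ≠ 0, A *ᵥ v = μ • v := by
  rw [← spectrum_toLin', ← Module.End.hasEigenvalue_iff_mem_spectrum] at h
  obtain ⟨v, hv⟩ := h.exists_hasEigenvector
  exact ⟨v, hv.2, by simpa using hv.apply_eq_smul⟩

/-- An eigenvalue of `X ↦ B * X * A` is a product of eigenvalues of `B` and `A`: right
multiplication by `A` has an eigenvector in the corresponding eigenspace. -/
theorem exists_mul_eq_of_mul_mul_eq_smul [IsAlgClosed K] {A B X : Matrix ι ι K} {w : K}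
    (hX : X ≠ 0) (h : B * X * A = w • X) :
    ∃ μ ∈ spectrum K B, ∃ ν ∈ spectrum K A, w = μ * ν := by
  let p := Module.End.eigenspace (LinearMap.mulLeft K B ∘ₗ LinearMap.mulRight K A) w
  have mem_p (Y : Matrix ι ι K) : Y ∈ p ↔ B * (Y * A) = w • Y := by
    simp [p]
  have hp : ∀ Y ∈ p, LinearMap.mulRight K A Y ∈ p := by
    intro Y hY
    rw [mem_p] at hY ⊢
    rw [LinearMap.mulRight_apply, ← mul_assoc, hY, smul_mul_assoc]
  have : Nontrivial p := ⟨⟨⟨X, (mem_p X).2 (by rw [← mul_assoc, h])⟩, 0,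
    fun h0 => hX (congrArg Subtype.val h0)⟩⟩
  obtain ⟨ν, hν⟩ := Module.End.exists_eigenvalue ((LinearMap.mulRight K A).restrict hp)
  obtain ⟨⟨Y, hYp⟩, hY⟩ := hν.exists_hasEigenvector
  have hY0 : Y ≠ 0 := fun h0 => hY.2 (Subtype.ext h0)
  have hYA : Y * A = ν • Y := congrArg Subtype.val hY.apply_eq_smul
  have hYw : ν • (B * Y) = w • Y := by
    rw [← mul_smul_comm, ← hYA]
    exact (mem_p Y).1 hYp
  have hνA : ν ∈ spectrum K A := by
    rw [← spectrum_transpose]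
    refine mem_spectrum_of_mul_eq_smul (X := Yᵀ) (by simpa using hY0) ?_
    rw [← transpose_mul, hYA, transpose_smul]
  rcases eq_or_ne ν 0 with rfl | hν0
  · have hw : w = 0 := by simpa [hY0, eq_comm] using hYw
    have : Nonempty ι := by
      by_contra hι
      rw [not_nonempty_iff] at hι
      exact hY0 (Subsingleton.elim _ _)
    obtain ⟨μ, hμ⟩ := spectrum.nonempty_of_isAlgClosed_of_finiteDimensional K B
    exact ⟨μ, hμ, 0, hνA, by simp [hw]⟩
  · refine ⟨w / ν, mem_spectrum_of_mul_eq_smul hY0 ?_, ν, hνA, (div_mul_cancel₀ w hν0).symm⟩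
    rw [div_eq_inv_mul, mul_smul, ← hYw, inv_smul_smul₀ hν0]

end Matrix


/-- **Spectrum of the discrete Lyapunov operator.**
For `A ∈ ℂ^{n×n}` with `n ≥ 1`, the spectrum of the linear endomorphism
`T(X) = X - Aᵀ X A` of the space of `n×n` complex matrices equals
`{1 - μ·ν : μ, ν eigenvalues of A}`. -/
theorem discrete_lyapunov_operator_spectrum
    {n : ℕ} (hn : 1 ≤ n) (A : Matrix (Fin n) (Fin n) ℂ)
    (T : Module.End ℂ (Matrix (Fin n) (Fin n) ℂ))
    (hT : ∀ X, T X = X - Aᵀ * X * A) :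
    spectrum ℂ T = {z : ℂ | ∃ μ ∈ spectrum ℂ A, ∃ ν ∈ spectrum ℂ A, z = 1 - μ * ν} := by
  ext z
  rw [← Module.End.hasEigenvalue_iff_mem_spectrum, Set.mem_ofPred_eq]
  constructor
  · intro hz
    obtain ⟨X, hX⟩ := hz.exists_hasEigenvector
    have hTX := hX.apply_eq_smul
    rw [hT] at hTX
    obtain ⟨μ, hμ, ν, hν, hw⟩ := exists_mul_eq_of_mul_mul_eq_smul (w := 1 - z) hX.2
      (show Aᵀ * X * A = (1 - z) • X by rw [sub_smul, one_smul, ← hTX, sub_sub_cancel])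
    rw [spectrum_transpose] at hμ
    exact ⟨μ, hμ, ν, hν, by rw [← hw, sub_sub_cancel]⟩
  · rintro ⟨μ, hμ, ν, hν, rfl⟩
    rw [← spectrum_transpose] at hμ hν
    obtain ⟨u, hu0, hu⟩ := exists_mulVec_eq_smul_of_mem_spectrum hμ
    obtain ⟨v, hv0, hv⟩ := exists_mulVec_eq_smul_of_mem_spectrum hν
    refine Module.End.hasEigenvalue_of_hasEigenvector (x := vecMulVec u v)
      ⟨Module.End.mem_eigenspace_iff.2 ?_, ?_⟩
    · rw [hT, mul_vecMulVec, vecMulVec_mul, hu, ← mulVec_transpose, hv, smul_vecMulVec,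
        vecMulVec_smul, sub_smul, one_smul, mul_smul]
    · simp [vecMulVec_eq_zero, hu0, hv0]
end

section
/- Let A ∈ ℝ^{n×n}, B ∈ ℝ^{n×m}, Q ∈ ℝ^{n×n}, with R ∈ ℝ^{m×m} and P₀ ∈ ℝ^{n×n} symmetric, and suppose M₀ := R + Bᵀ P₀ B is invertible. Define K₀ := M₀^{-1} Bᵀ P₀ A and A_cl := A − B K₀. Let 𝒜 ∈ ℝ^{n×n} and ℬ ∈ ℝ^{n×m} be arbitrary perturbation directions. Then the map t ↦ P₀ − Q − (A+t𝒜)ᵀ P₀ (A+t𝒜) + (A+t𝒜)ᵀ P₀ (B+tℬ) (R + (B+tℬ)ᵀ P₀ (B+tℬ))^{-1} (B+tℬ)ᵀ P₀ (A+t𝒜), well-defined for t in a neighborhood of 0, is differentiable at t = 0 with derivative −(𝒜 − ℬ K₀)ᵀ P₀ A_cl − A_clᵀ P₀ (𝒜 − ℬ K₀). -/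
open Matrix

attribute [local instance] Matrix.normedAddCommGroup Matrix.normedSpace

theorem Matrix.hasDerivAt_iff_entries {k l : ℕ} {F : ℝ → Matrix (Fin k) (Fin l) ℝ}
    {F' : Matrix (Fin k) (Fin l) ℝ} {x : ℝ} :
    HasDerivAt F F' x ↔ ∀ i j, HasDerivAt (fun t => F t i j) (F' i j) x := by
  refine Iff.trans hasDerivAt_pi (forall_congr' fun i => ?_)
  exact hasDerivAt_pi

theorem HasDerivAt.matrix_mul {k l p : ℕ} {F : ℝ → Matrix (Fin k) (Fin l) ℝ}
    {G : ℝ → Matrix (Fin l) (Fin p) ℝ} {F' : Matrix (Fin k) (Fin l) ℝ}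
    {G' : Matrix (Fin l) (Fin p) ℝ} {x : ℝ} (hF : HasDerivAt F F' x) (hG : HasDerivAt G G' x) :
    HasDerivAt (fun t => F t * G t) (F' * G x + F x * G') x := by
  rw [Matrix.hasDerivAt_iff_entries] at *
  intro i j
  simp only [Matrix.add_apply, Matrix.mul_apply, ← Finset.sum_add_distrib]
  exact HasDerivAt.fun_sum fun q _ => (hF i q).mul (hG q j)

theorem HasDerivAt.matrix_transpose {k l : ℕ} {F : ℝ → Matrix (Fin k) (Fin l) ℝ}
    {F' : Matrix (Fin k) (Fin l) ℝ} {x : ℝ} (hF : HasDerivAt F F' x) :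
    HasDerivAt (fun t => (F t)ᵀ) F'ᵀ x := by
  rw [Matrix.hasDerivAt_iff_entries] at *
  exact fun i j => hF j i

theorem HasDerivAt.matrix_inv {k : ℕ} {F : ℝ → Matrix (Fin k) (Fin k) ℝ}
    {F' : Matrix (Fin k) (Fin k) ℝ} {x : ℝ} (hF : HasDerivAt F F' x) (hx : IsUnit (F x)) :
    HasDerivAt (fun t => (F t)⁻¹) (-((F x)⁻¹ * F' * (F x)⁻¹)) x := by
  have hdet : (F x).det ≠ 0 := ((Matrix.isUnit_iff_isUnit_det _).1 hx).ne_zero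
  have hcont : ContinuousAt F x := hF.continuousAt
  have hdetc : ContinuousAt (fun t => (F t).det) x :=
    (Continuous.matrix_det continuous_id).continuousAt.comp hcont
  have hinv : ContinuousAt (fun t => (F t)⁻¹) x := by
    simp only [Matrix.inv_def, Ring.inverse_eq_inv']
    exact (hdetc.inv₀ hdet).smul
      ((Continuous.matrix_adjugate continuous_id).continuousAt.comp hcont)
  have hne : ∀ᶠ t in nhdsWithin x {x}ᶜ, (F t).det ≠ 0 :=
    (hdetc.eventually_ne hdet).filter_mono nhdsWithin_le_nhds
  replace hF := hasDerivAt_iff_tendsto_slope.1 hF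
  refine hasDerivAt_iff_tendsto_slope.2 ?_
  have hmul : Continuous fun p : Matrix (Fin k) (Fin k) ℝ × Matrix (Fin k) (Fin k) ℝ =>
      -(p.1 * p.2 * (F x)⁻¹) :=
    ((continuous_fst.matrix_mul continuous_snd).matrix_mul continuous_const).neg
  have hlim := (hmul.tendsto ((F x)⁻¹, F')).comp
    ((hinv.tendsto.mono_left nhdsWithin_le_nhds).prodMk_nhds hF)
  refine hlim.congr' ?_
  filter_upwards [hne] with t ht
  have h₁ : (F t)⁻¹ * (F t * (F x)⁻¹) = (F x)⁻¹ :=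
    Matrix.nonsing_inv_mul_cancel_left _ _ ht.isUnit
  have h₂ : F x * (F x)⁻¹ = 1 := Matrix.mul_nonsing_inv _ hdet.isUnit
  simp only [Function.comp_apply, slope_def_module, Matrix.mul_smul, Matrix.smul_mul,
    Matrix.mul_sub, Matrix.sub_mul, h₁, Matrix.mul_assoc, h₂, Matrix.mul_one,
    ← smul_neg, neg_sub]

theorem hasDerivAt_const_add_id_smul {k l : ℕ} (C D : Matrix (Fin k) (Fin l) ℝ) :
    HasDerivAt (fun t : ℝ => C + t • D) D 0 := by
  refine Matrix.hasDerivAt_iff_entries.2 fun i j => ?_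
  simpa using (hasDerivAt_mul_const (D i j)).const_add (C i j)

/-- **Parameter derivative of the DARE residual at fixed `P₀`.**
With `R`, `P₀` symmetric, `M₀ := R + Bᵀ P₀ B` invertible, `K₀ := M₀⁻¹ Bᵀ P₀ A`,
`A_cl := A - B K₀`, and arbitrary perturbation directions `𝒜 ∈ ℝ^{n×n}` (here `Ad`)
and `ℬ ∈ ℝ^{n×m}` (here `Bd`), the map
`t ↦ P₀ - Q - (A+t𝒜)ᵀ P₀ (A+t𝒜) + (A+t𝒜)ᵀ P₀ (B+tℬ) (R + (B+tℬ)ᵀ P₀ (B+tℬ))⁻¹ (B+tℬ)ᵀ P₀ (A+t𝒜)`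
is differentiable at `t = 0` with derivative
`-(𝒜 - ℬ K₀)ᵀ P₀ A_cl - A_clᵀ P₀ (𝒜 - ℬ K₀)`. -/
theorem dare_residual_parameter_derivative
    {n m : ℕ}
    (A : Matrix (Fin n) (Fin n) ℝ) (B : Matrix (Fin n) (Fin m) ℝ)
    (Q : Matrix (Fin n) (Fin n) ℝ) (R : Matrix (Fin m) (Fin m) ℝ)
    (P₀ : Matrix (Fin n) (Fin n) ℝ)
    (hR : Rᵀ = R) (hP₀ : P₀ᵀ = P₀)
    (M₀ : Matrix (Fin m) (Fin m) ℝ) (hM₀ : M₀ = R + Bᵀ * P₀ * B)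
    (hM₀unit : IsUnit M₀)
    (K₀ : Matrix (Fin m) (Fin n) ℝ) (hK₀ : K₀ = M₀⁻¹ * Bᵀ * P₀ * A)
    (Acl : Matrix (Fin n) (Fin n) ℝ) (hAcl : Acl = A - B * K₀)
    (Ad : Matrix (Fin n) (Fin n) ℝ) (Bd : Matrix (Fin n) (Fin m) ℝ) :
    HasDerivAt (fun t : ℝ =>
        P₀ - Q - (A + t • Ad)ᵀ * P₀ * (A + t • Ad)
          + (A + t • Ad)ᵀ * P₀ * (B + t • Bd)
            * (R + (B + t • Bd)ᵀ * P₀ * (B + t • Bd))⁻¹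
            * (B + t • Bd)ᵀ * P₀ * (A + t • Ad))
      (-((Ad - Bd * K₀)ᵀ * P₀ * Acl) - Aclᵀ * P₀ * (Ad - Bd * K₀)) 0 := by
  have hA := hasDerivAt_const_add_id_smul A Ad
  have hB := hasDerivAt_const_add_id_smul B Bd
  have hP := hasDerivAt_const (0 : ℝ) P₀
  have hM := ((hB.matrix_transpose.matrix_mul hP).matrix_mul hB).const_add R
  have hunit : IsUnit (R + (B + (0 : ℝ) • Bd)ᵀ * P₀ * (B + (0 : ℝ) • Bd)) := by
    simpa [← hM₀] using hM₀unit
  have hAP := hA.matrix_transpose.matrix_mul hP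
  have hder := ((hAP.matrix_mul hA).const_sub (P₀ - Q)).add
    (((((hAP.matrix_mul hB).matrix_mul (hM.matrix_inv hunit)).matrix_mul
      hB.matrix_transpose).matrix_mul hP).matrix_mul hA)
  have hMt : M₀ᵀ = M₀ := by
    simp [hM₀, hR, hP₀, Matrix.mul_assoc]
  refine hder.congr_deriv ?_
  simp only [zero_smul, add_zero, ← hM₀]
  subst hAcl hK₀
  simp only [Matrix.transpose_sub, Matrix.transpose_mul, Matrix.transpose_nonsing_inv, hMt, hP₀,
    Matrix.transpose_transpose, Matrix.mul_zero, Matrix.mul_add, Matrix.add_mul, Matrix.mul_sub,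
    Matrix.sub_mul, Matrix.mul_neg, Matrix.neg_mul, Matrix.mul_assoc, add_zero]
  abel
end
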